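/- arXiv:2212.02680 — 2 statements merged into one kernel-verified Lean document; each statement's English description precedes it below -/
import Mathlib

section
/- Let X be a compact metric space, P and Q weak*-compact subsets of Δ(X), and ε > 0. There exist P in the closed convex hull of P and Q in the closed convex hull of Q with ‖P − Q‖₁ ≤ ε if, and only if, for every continuous function f : X → ℝ with ‖f‖_∞ = 1 one has min over P ∈ P of ∫_X f dP ≤ (max over Q ∈ Q of ∫_X f dQ) + ε. -/
open MeasureTheory
open scoped NNReal

noncomputable section

/-- Total variation distance between two finite measures. -/
def tvDist {X : Type*} [MeasurableSpace X] (P Q : FiniteMeasure X) : ℝ :=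
  ((P.toMeasure.toSignedMeasure - Q.toMeasure.toSignedMeasure).totalVariation Set.univ).toReal

/-- Closed convex hull (weak* topology) of a set of probability measures, inside finite measures. -/
def cchull {X : Type*} [MeasurableSpace X] [TopologicalSpace X] [OpensMeasurableSpace X]
    (S : Set (ProbabilityMeasure X)) : Set (FiniteMeasure X) :=
  closure (convexHull ℝ≥0 (ProbabilityMeasure.toFiniteMeasure '' S))

section TotalVariation

variable {X : Type*} [MeasurableSpace X]

lemma toMeasure_add_negPart_eq (P Q : FiniteMeasure X) :
    P.toMeasure + (P.toMeasure.toSignedMeasure -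
        Q.toMeasure.toSignedMeasure).toJordanDecomposition.negPart =
      Q.toMeasure + (P.toMeasure.toSignedMeasure -
        Q.toMeasure.toSignedMeasure).toJordanDecomposition.posPart := by
  set s := P.toMeasure.toSignedMeasure - Q.toMeasure.toSignedMeasure with hs
  rw [← Measure.toSignedMeasure_eq_toSignedMeasure_iff, Measure.toSignedMeasure_add,
    Measure.toSignedMeasure_add]
  have h := s.toSignedMeasure_toJordanDecomposition
  rw [JordanDecomposition.toSignedMeasure] at h
  rw [← sub_eq_zero]
  calc _ = s - (s.toJordanDecomposition.posPart.toSignedMeasure -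
        s.toJordanDecomposition.negPart.toSignedMeasure) := by rw [hs]; abel
    _ = 0 := by rw [h, sub_self]

lemma tvDist_eq (P Q : FiniteMeasure X) :
    tvDist P Q =
      (P.toMeasure.toSignedMeasure -
        Q.toMeasure.toSignedMeasure).toJordanDecomposition.posPart.real Set.univ +
      (P.toMeasure.toSignedMeasure -
        Q.toMeasure.toSignedMeasure).toJordanDecomposition.negPart.real Set.univ := by
  rw [tvDist, SignedMeasure.totalVariation, Measure.add_apply,
    ENNReal.toReal_add (measure_ne_top _ _) (measure_ne_top _ _)]
  rfl

variable [TopologicalSpace X] [CompactSpace X]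

lemma integrable_continuousMap [OpensMeasurableSpace X] (μ : Measure X) [IsFiniteMeasure μ]
    (f : C(X, ℝ)) : Integrable f μ :=
  Integrable.of_bound (C := ‖f‖) (f.continuous.aestronglyMeasurable)
    (.of_forall fun x => f.norm_coe_le_norm x)

lemma integral_sub_integral_eq_jordan [OpensMeasurableSpace X] (P Q : FiniteMeasure X)
    (f : C(X, ℝ)) :
    ∫ x, f x ∂P.toMeasure - ∫ x, f x ∂Q.toMeasure =
      ∫ x, f x ∂(P.toMeasure.toSignedMeasure -
        Q.toMeasure.toSignedMeasure).toJordanDecomposition.posPart -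
      ∫ x, f x ∂(P.toMeasure.toSignedMeasure -
        Q.toMeasure.toSignedMeasure).toJordanDecomposition.negPart := by
  have h := congrArg (fun μ : Measure X => ∫ x, f x ∂μ) (toMeasure_add_negPart_eq P Q)
  beta_reduce at h
  rw [integral_add_measure (integrable_continuousMap _ f) (integrable_continuousMap _ f),
    integral_add_measure (integrable_continuousMap _ f) (integrable_continuousMap _ f)] at h
  linarith

lemma abs_integral_continuousMap_le (μ : Measure X) [IsFiniteMeasure μ] (f : C(X, ℝ)) :
    |∫ x, f x ∂μ| ≤ ‖f‖ * μ.real Set.univ :=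
  norm_integral_le_of_norm_le_const (.of_forall fun x => f.norm_coe_le_norm x)

lemma integral_sub_integral_le_norm_mul_tvDist [OpensMeasurableSpace X] (P Q : FiniteMeasure X)
    (f : C(X, ℝ)) :
    ∫ x, f x ∂P.toMeasure - ∫ x, f x ∂Q.toMeasure ≤ ‖f‖ * tvDist P Q := by
  rw [integral_sub_integral_eq_jordan, tvDist_eq, mul_add]
  have h₁ := abs_le.1 (abs_integral_continuousMap_le
    (P.toMeasure.toSignedMeasure - Q.toMeasure.toSignedMeasure).toJordanDecomposition.posPart f)
  have h₂ := abs_le.1 (abs_integral_continuousMap_le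
    (P.toMeasure.toSignedMeasure - Q.toMeasure.toSignedMeasure).toJordanDecomposition.negPart f)
  linarith

end TotalVariation

lemma abs_sub_clamp_le {a b : ℝ} (ha : |a| ≤ 1) : |a - max (-1) (min b 1)| ≤ |a - b| := by
  rcases abs_le.1 ha with ⟨h₁, h₂⟩
  rcases le_total b 1 with h | h
  · rw [min_eq_left h]
    rcases le_total (-1) b with h' | h'
    · rw [max_eq_right h']
    · rw [max_eq_left h', abs_of_nonneg (by linarith), abs_of_nonneg (by linarith)]
      linarith
  · rw [min_eq_right h, max_eq_right (by norm_num), abs_of_nonpos (by linarith),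
      abs_of_nonpos (by linarith)]
    linarith

/-- A measurable function bounded by `1` is approximated in `L¹` by continuous functions of norm
at most `1`. -/
lemma exists_continuousMap_norm_le_one_integral_sub_le {X : Type*} [TopologicalSpace X]
    [CompactSpace X] [NormalSpace X] [MeasurableSpace X] [BorelSpace X] (μ : Measure X)
    [IsFiniteMeasure μ] [μ.WeaklyRegular] {h : X → ℝ} (hm : Measurable h) (hb : ∀ x, |h x| ≤ 1)
    {δ : ℝ} (hδ : 0 < δ) :
    ∃ f : C(X, ℝ), ‖f‖ ≤ 1 ∧ ∫ x, |h x - f x| ∂μ ≤ δ := by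
  have hi : Integrable h μ := Integrable.of_bound (C := 1) hm.aestronglyMeasurable
    (.of_forall hb)
  obtain ⟨g, hg, hgi⟩ := hi.exists_boundedContinuous_integral_sub_le hδ
  let f : C(X, ℝ) := ⟨fun x => max (-1) (min (g x) 1), by fun_prop⟩
  refine ⟨f, (ContinuousMap.norm_le _ zero_le_one).2 fun x => ?_, le_trans ?_ hg⟩
  · exact abs_le.2 ⟨le_max_left _ _, max_le (by norm_num) (min_le_right _ _)⟩
  · exact integral_mono (hi.sub (integrable_continuousMap μ f)).abs (hi.sub hgi).norm
      fun x => abs_sub_clamp_le (hb x)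

/-- Duality formula: the total variation is controlled by tests on continuous functions. -/
lemma tvDist_le_of_forall_integral_sub_le {X : Type*} [MetricSpace X] [CompactSpace X]
    [MeasurableSpace X] [BorelSpace X] {P Q : FiniteMeasure X} {ε : ℝ}
    (H : ∀ f : C(X, ℝ), ‖f‖ ≤ 1 → ∫ x, f x ∂P.toMeasure - ∫ x, f x ∂Q.toMeasure ≤ ε) :
    tvDist P Q ≤ ε := by
  classical
  refine le_of_forall_pos_le_add fun δ hδ => ?_
  rw [tvDist_eq]
  simp only [integral_sub_integral_eq_jordan] at H
  generalize (P.toMeasure.toSignedMeasure -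
    Q.toMeasure.toSignedMeasure).toJordanDecomposition = j at H ⊢
  obtain ⟨A, hA, hpA, hnA⟩ := j.mutuallySingular
  let h : X → ℝ := A.piecewise (fun _ => -1) (fun _ => 1)
  have hm : Measurable h := measurable_const.piecewise hA measurable_const
  have hb : ∀ x, |h x| ≤ 1 := fun x => by
    by_cases hx : x ∈ A <;> simp [h, hx]
  have hi (μ : Measure X) [IsFiniteMeasure μ] : Integrable h μ :=
    Integrable.of_bound (C := 1) hm.aestronglyMeasurable (.of_forall hb)
  have hp : ∫ x, h x ∂j.posPart = j.posPart.real Set.univ := by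
    have : h =ᵐ[j.posPart] fun _ => 1 := by
      filter_upwards [measure_eq_zero_iff_ae_notMem.1 hpA] with x hx
      simp [h, hx]
    rw [integral_congr_ae this]; simp
  have hn : ∫ x, h x ∂j.negPart = -j.negPart.real Set.univ := by
    have : h =ᵐ[j.negPart] fun _ => -1 := by
      filter_upwards [measure_eq_zero_iff_ae_notMem.1 hnA] with x hx
      have hx' : x ∈ A := not_not.1 hx
      simp [h, hx']
    rw [integral_congr_ae this]; simp
  obtain ⟨f, hf, hfd⟩ :=
    exists_continuousMap_norm_le_one_integral_sub_le (j.posPart + j.negPart) hm hb hδ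
  have hd (μ : Measure X) [IsFiniteMeasure μ] : Integrable (fun x => h x - f x) μ :=
    (hi μ).sub (integrable_continuousMap μ f)
  rw [integral_add_measure (hd _).abs (hd _).abs] at hfd
  have h₁ := (abs_le.1 (abs_integral_le_integral_abs (μ := j.posPart)
    (f := fun x => h x - f x))).2
  have h₂ := (abs_le.1 (abs_integral_le_integral_abs (μ := j.negPart)
    (f := fun x => h x - f x))).1
  rw [integral_sub (hi _) (integrable_continuousMap _ f)] at h₁ h₂
  linarith [H f hf]

lemma integral_smul_add_smul {X : Type*} [MeasurableSpace X] (μ ν : FiniteMeasure X) (a b : ℝ≥0)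
    {f : X → ℝ}
    (hμ : Integrable f μ.toMeasure) (hν : Integrable f ν.toMeasure) :
    ∫ x, f x ∂(a • μ + b • ν).toMeasure =
      a * ∫ x, f x ∂μ.toMeasure + b * ∫ x, f x ∂ν.toMeasure := by
  rw [FiniteMeasure.toMeasure_add, FiniteMeasure.toMeasure_smul, FiniteMeasure.toMeasure_smul,
    integral_add_measure hμ.smul_measure_nnreal hν.smul_measure_nnreal,
    integral_smul_nnreal_measure, integral_smul_nnreal_measure]
  rfl

section ClosedConvexHull

variable {X : Type*} [MeasurableSpace X] [TopologicalSpace X] [OpensMeasurableSpace X]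

lemma toFiniteMeasure_mem_cchull {S : Set (ProbabilityMeasure X)} {P : ProbabilityMeasure X}
    (hP : P ∈ S) : P.toFiniteMeasure ∈ cchull S :=
  subset_closure (subset_convexHull _ _ (Set.mem_image_of_mem _ hP))

lemma convex_cchull (S : Set (ProbabilityMeasure X)) : Convex ℝ≥0 (cchull S) := by
  intro x hx y hy a b ha hb hab
  refine map_mem_closure₂ (f := fun x' y' : FiniteMeasure X => a • x' + b • y') (by fun_prop)
    hx hy fun x' hx' y' hy' => convex_convexHull _ _ hx' hy' ha hb hab

variable [CompactSpace X]

lemma le_integral_of_mem_cchull {S : Set (ProbabilityMeasure X)} {c : ℝ} {f : C(X, ℝ)}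
    (hS : ∀ P ∈ S, c ≤ ∫ x, f x ∂(P : Measure X)) {P : FiniteMeasure X} (hP : P ∈ cchull S) :
    c ≤ ∫ x, f x ∂P.toMeasure := by
  refine closure_minimal (t := {μ : FiniteMeasure X | c ≤ ∫ x, f x ∂μ.toMeasure})
    (convexHull_min ?_ ?_)
    (isClosed_le continuous_const (FiniteMeasure.continuous_integral_continuousMap f)) hP
  · rintro _ ⟨P, hP, rfl⟩
    exact hS P hP
  · intro μ hμ ν hν a b _ _ hab
    simp only [Set.mem_ofPred_eq] at hμ hν ⊢
    rw [integral_smul_add_smul _ _ _ _ (integrable_continuousMap _ f)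
      (integrable_continuousMap _ f)]
    have hab' : (a : ℝ) + b = 1 := by exact_mod_cast hab
    calc c = a * c + b * c := by rw [← add_mul, hab', one_mul]
      _ ≤ _ := by gcongr

lemma integral_le_of_mem_cchull {S : Set (ProbabilityMeasure X)} {c : ℝ} {f : C(X, ℝ)}
    (hS : ∀ P ∈ S, ∫ x, f x ∂(P : Measure X) ≤ c) {P : FiniteMeasure X} (hP : P ∈ cchull S) :
    ∫ x, f x ∂P.toMeasure ≤ c := by
  have := le_integral_of_mem_cchull (c := -c) (f := -f)
    (fun P hP => by simpa [integral_neg] using hS P hP) hP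
  simpa [integral_neg] using this

/-- Integration against a finite measure, as an element of the weak dual of `C(X, ℝ)`. -/
def integralWeakDual (μ : FiniteMeasure X) : WeakDual ℝ C(X, ℝ) :=
  StrongDual.toWeakDual <| LinearMap.mkContinuous
    { toFun := fun f => ∫ x, f x ∂μ.toMeasure
      map_add' := fun f g => integral_add (integrable_continuousMap _ f)
        (integrable_continuousMap _ g)
      map_smul' := fun c f => integral_const_mul c f }
    (μ.toMeasure.real Set.univ)
    fun f => (abs_integral_continuousMap_le _ f).trans_eq (mul_comm _ _)

@[simp]
lemma integralWeakDual_apply (μ : FiniteMeasure X) (f : C(X, ℝ)) :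
    integralWeakDual μ f = ∫ x, f x ∂μ.toMeasure := rfl

lemma continuous_integralWeakDual : Continuous (integralWeakDual (X := X)) :=
  WeakDual.continuous_of_continuous_eval FiniteMeasure.continuous_integral_continuousMap

lemma convex_image_integralWeakDual {S : Set (FiniteMeasure X)} (hS : Convex ℝ≥0 S) :
    Convex ℝ (integralWeakDual '' S) := by
  rintro _ ⟨μ, hμ, rfl⟩ _ ⟨ν, hν, rfl⟩ a b ha hb hab
  lift a to ℝ≥0 using ha
  lift b to ℝ≥0 using hb
  refine ⟨a • μ + b • ν, hS hμ hν a.2 b.2 (by exact_mod_cast hab), DFunLike.ext _ _ fun f => ?_⟩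
  exact integral_smul_add_smul _ _ _ _ (integrable_continuousMap _ f)
    (integrable_continuousMap _ f)

end ClosedConvexHull

section Compactness

variable {X : Type*} [MetricSpace X] [CompactSpace X] [MeasurableSpace X] [BorelSpace X]

lemma isCompact_cchull (S : Set (ProbabilityMeasure X)) : IsCompact (cchull S) := by
  have hK : IsCompact (Set.range (ProbabilityMeasure.toFiniteMeasure (Ω := X))) :=
    isCompact_range ProbabilityMeasure.toFiniteMeasure_continuous
  refine hK.of_isClosed_subset isClosed_closure
    (closure_minimal (convexHull_min (Set.image_subset_range _ _) ?_) hK.isClosed)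
  rintro _ ⟨μ, rfl⟩ _ ⟨ν, rfl⟩ a b _ _ hab
  refine ⟨⟨(a • μ.toFiniteMeasure + b • ν.toFiniteMeasure).toMeasure, ⟨?_⟩⟩, rfl⟩
  have hab' : (a : ENNReal) + b = 1 := by exact_mod_cast hab
  rw [FiniteMeasure.toMeasure_add, FiniteMeasure.toMeasure_smul, FiniteMeasure.toMeasure_smul,
    Measure.add_apply, Measure.smul_apply, Measure.smul_apply]
  change a • (μ : Measure X) Set.univ + b • (ν : Measure X) Set.univ = 1
  rwa [measure_univ, measure_univ, ENNReal.smul_def, ENNReal.smul_def, smul_eq_mul, smul_eq_mul,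
    mul_one, mul_one]

end Compactness

/-- Strict separation in the weak dual, with the separating functional given by evaluation. -/
lemma WeakDual.exists_eval_separating {E : Type*} [NormedAddCommGroup E] [NormedSpace ℝ E]
    {s t : Set (WeakDual ℝ E)} (hs : Convex ℝ s) (hsc : IsCompact s) (ht : Convex ℝ t)
    (htc : IsClosed t) (hst : Disjoint s t) :
    ∃ (g : E) (u v : ℝ), (∀ a ∈ s, a g < u) ∧ u < v ∧ ∀ b ∈ t, v < b g := by
  have : LocallyConvexSpace ℝ (WeakDual ℝ E) :=
    inferInstanceAs (LocallyConvexSpace ℝ (WeakBilin (topDualPairing ℝ E)))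
  obtain ⟨F, u, v, hF⟩ := geometric_hahn_banach_compact_closed hs hsc ht htc hst
  obtain ⟨g, rfl⟩ := LinearMap.dualEmbedding_surjective (topDualPairing ℝ E) F
  exact ⟨g, u, v, hF⟩

open scoped Pointwise in
lemma exists_tvDist_le_of_forall_sInf_le_sSup_add {X : Type*} [MetricSpace X] [CompactSpace X]
    [MeasurableSpace X] [BorelSpace X] {𝒮 𝒬 : Set (ProbabilityMeasure X)}
    (h𝒮ne : 𝒮.Nonempty) (h𝒬ne : 𝒬.Nonempty) {ε : ℝ} (hε : 0 < ε)
    (H : ∀ f : C(X, ℝ), ‖f‖ = 1 →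
      sInf ((fun P : ProbabilityMeasure X => ∫ x, f x ∂(P : Measure X)) '' 𝒮) ≤
        sSup ((fun Q : ProbabilityMeasure X => ∫ x, f x ∂(Q : Measure X)) '' 𝒬) + ε) :
    ∃ P ∈ cchull 𝒮, ∃ Q ∈ cchull 𝒬, tvDist P Q ≤ ε := by
  let B : Set (WeakDual ℝ C(X, ℝ)) := WeakDual.toStrongDual ⁻¹' Metric.closedBall 0 ε
  have hBconv : Convex ℝ B :=
    (convex_closedBall (0 : StrongDual ℝ C(X, ℝ)) ε).linear_preimage
      (WeakDual.toStrongDual (𝕜 := ℝ) (E := C(X, ℝ))).toLinearMap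
  have hS := (isCompact_cchull 𝒮).image continuous_integralWeakDual
  have hQ := (isCompact_cchull 𝒬).image continuous_integralWeakDual
  have hT := hQ.add (WeakDual.isCompact_closedBall (0 : StrongDual ℝ C(X, ℝ)) ε)
  by_cases hd : Disjoint (integralWeakDual '' cchull 𝒬 + B) (integralWeakDual '' cchull 𝒮)
  · exfalso
    obtain ⟨g, u, v, hu, huv, hv⟩ := WeakDual.exists_eval_separating
      ((convex_image_integralWeakDual (convex_cchull 𝒬)).add hBconv) hT
      (convex_image_integralWeakDual (convex_cchull 𝒮)) hS.isClosed hd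
    have hPv : ∀ P ∈ 𝒮, v < ∫ x, g x ∂(P : Measure X) := fun P hP =>
      hv _ ⟨_, toFiniteMeasure_mem_cchull hP, rfl⟩
    have hQu : ∀ Q ∈ 𝒬, ∀ w ∈ B, ∫ x, g x ∂(Q : Measure X) + w g < u := fun Q hQ w hw =>
      hu _ (Set.add_mem_add ⟨_, toFiniteMeasure_mem_cchull hQ, rfl⟩ hw)
    have hg : g ≠ 0 := by
      rintro rfl
      obtain ⟨P, hP⟩ := h𝒮ne
      obtain ⟨Q, hQ⟩ := h𝒬ne
      have h₁ := hPv P hP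
      have h₂ := hQu Q hQ 0 (by simp [B, hε.le])
      simp at h₁ h₂
      linarith
    have hg' : 0 < ‖g‖ := norm_pos_iff.2 hg
    obtain ⟨w, hw, hwg⟩ := exists_dual_vector ℝ g hg'.ne'
    have hwB : StrongDual.toWeakDual (ε • w) ∈ B := by
      change ε • w ∈ Metric.closedBall 0 ε
      rw [mem_closedBall_zero_iff, norm_smul, hw, mul_one, Real.norm_of_nonneg hε.le]
    have hint (μ : Measure X) : ∫ x, (‖g‖⁻¹ • g) x ∂μ = ‖g‖⁻¹ * ∫ x, g x ∂μ :=
      integral_const_mul _ _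
    have h := H (‖g‖⁻¹ • g) (by rw [norm_smul, norm_inv, norm_norm, inv_mul_cancel₀ hg'.ne'])
    have h₁ : ‖g‖⁻¹ * v ≤ sInf ((fun P : ProbabilityMeasure X =>
        ∫ x, (‖g‖⁻¹ • g) x ∂(P : Measure X)) '' 𝒮) := by
      refine le_csInf (h𝒮ne.image _) ?_
      rintro _ ⟨P, hP, rfl⟩
      simp only [hint]
      have := (hPv P hP).le
      gcongr
    have h₂ : sSup ((fun Q : ProbabilityMeasure X =>
        ∫ x, (‖g‖⁻¹ • g) x ∂(Q : Measure X)) '' 𝒬) ≤ ‖g‖⁻¹ * (u - ε * ‖g‖) := by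
      refine csSup_le (h𝒬ne.image _) ?_
      rintro _ ⟨Q, hQ, rfl⟩
      simp only [hint]
      have h₃ := hQu Q hQ _ hwB
      have h₄ : StrongDual.toWeakDual (ε • w) g = ε * ‖g‖ := congrArg (ε * ·) hwg
      rw [h₄] at h₃
      have : ∫ x, g x ∂(Q : Measure X) ≤ u - ε * ‖g‖ := by linarith
      gcongr
    have h₅ : ‖g‖⁻¹ * (u - ε * ‖g‖) + ε = ‖g‖⁻¹ * u := by field_simp; ring
    have h₆ : ‖g‖⁻¹ * u < ‖g‖⁻¹ * v := by gcongr
    linarith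
  · obtain ⟨_, ⟨_, ⟨Q, hQ, rfl⟩, w, hw, rfl⟩, P, hP, hPQ⟩ := Set.not_disjoint_iff.1 hd
    refine ⟨P, hP, Q, hQ, tvDist_le_of_forall_integral_sub_le fun f hf => ?_⟩
    have h₁ : ∫ x, f x ∂P.toMeasure = ∫ x, f x ∂Q.toMeasure + w f :=
      DFunLike.congr_fun hPQ f
    have hw' : ‖WeakDual.toStrongDual w‖ ≤ ε :=
      (dist_zero_right (E := StrongDual ℝ C(X, ℝ)) (WeakDual.toStrongDual w)).symm.trans_le hw
    have h₂ : w f ≤ ε := calc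
      w f ≤ ‖WeakDual.toStrongDual w f‖ := le_abs_self _
      _ ≤ ε * ‖f‖ := (WeakDual.toStrongDual w).le_of_opNorm_le hw' f
      _ ≤ ε := mul_le_of_le_one_right hε.le hf
    linarith

theorem stmt4 {X : Type*} [MetricSpace X] [CompactSpace X] [MeasurableSpace X] [BorelSpace X]
    (𝒮 𝒬 : Set (ProbabilityMeasure X)) (h𝒮 : IsCompact 𝒮) (h𝒬 : IsCompact 𝒬)
    (h𝒮ne : 𝒮.Nonempty) (h𝒬ne : 𝒬.Nonempty)
    (ε : ℝ) (hε : 0 < ε) :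
    (∃ P ∈ cchull 𝒮, ∃ Q ∈ cchull 𝒬, tvDist P Q ≤ ε) ↔
      ∀ f : C(X, ℝ), ‖f‖ = 1 →
        sInf ((fun P : ProbabilityMeasure X => ∫ x, f x ∂(P : Measure X)) '' 𝒮) ≤
          sSup ((fun Q : ProbabilityMeasure X => ∫ x, f x ∂(Q : Measure X)) '' 𝒬) + ε := by
  constructor
  · rintro ⟨P, hP, Q, hQ, hPQ⟩ f hf
    have hc := ProbabilityMeasure.continuous_integral_continuousMap f
    have h₁ := le_integral_of_mem_cchull (f := f) (fun P hP =>
      csInf_le (h𝒮.image hc).bddBelow (Set.mem_image_of_mem _ hP)) hP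
    have h₂ := integral_le_of_mem_cchull (f := f) (fun Q hQ =>
      le_csSup (h𝒬.image hc).bddAbove (Set.mem_image_of_mem _ hQ)) hQ
    have h₃ := integral_sub_integral_le_norm_mul_tvDist P Q f
    rw [hf, one_mul] at h₃
    linarith
  · exact exists_tvDist_le_of_forall_sInf_le_sSup_add h𝒮ne h𝒬ne hε

end
end

section
/- Let Y be a finite set with N_Y elements, D the family of all nonempty subsets of Y, X = {(y, B) : B ∈ D, y ∈ B}, L the set of strict linear orders on Y, and a_≻(y, B) = 1 if y is the ≻-maximal element of B and 0 otherwise. Let ε ∈ [0,1]. If a stochastic choice function P₀ satisfies ε-ARSP* (for every t : X → ℕ, Σ P₀(y,B)·t(y,B) ≤ (1 − ε)·max_{≻ ∈ L} Σ a_≻(y,B)·t(y,B) + (2^{N_Y} − 1)·ε·max t), then P₀ satisfies ε̄-ARSP with ε̄ = (2^{N_Y + 1} − 2)·ε, i.e., for every t : X → ℕ, Σ P₀(y,B)·t(y,B) ≤ max_{≻ ∈ L} Σ a_≻(y,B)·t(y,B) + (max t − min t)·ε̄/2. -/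
noncomputable section

/-- The type of strict linear orders (irreflexive, transitive, total relations) on `Y`. -/
abbrev SLO (Y : Type*) := {r : Y → Y → Prop // IsStrictTotalOrder Y r}

noncomputable instance {Y : Type*} [Finite Y] : Fintype (SLO Y) := Fintype.ofFinite _

instance {Y : Type*} : Nonempty (SLO Y) := ⟨⟨WellOrderingRel, inferInstance⟩⟩

open Classical in
/-- `a_≻(y,B) = 1` if no `y' ∈ B` satisfies `y' ≻ y`, and `0` otherwise. -/
def aFn {Y : Type*} (r : Y → Y → Prop) (y : Y) (B : Finset Y) : ℝ :=
  if ∀ y' ∈ B, ¬ r y' y then 1 else 0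

/-- The set `X` of pairs `(y, B)` with `B` a nonempty subset of `Y` and `y ∈ B`. -/
def allPairs (Y : Type*) [Fintype Y] [DecidableEq Y] : Finset (Y × Finset Y) :=
  Finset.univ.filter fun p => p.1 ∈ p.2

theorem allPairs_nonempty {Y : Type*} [Fintype Y] [DecidableEq Y] [Nonempty Y] :
    (allPairs Y).Nonempty := by
  obtain ⟨y⟩ := ‹Nonempty Y›
  exact ⟨(y, {y}), by simp [allPairs]⟩

/-- Maximum value of `t` over the pairs `(y, B)` with `y ∈ B`. -/
def maxT {Y : Type*} [Fintype Y] [DecidableEq Y] [Nonempty Y] (t : Y → Finset Y → ℕ) : ℕ :=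
  (allPairs Y).sup' allPairs_nonempty fun p => t p.1 p.2

/-- Minimum value of `t` over the pairs `(y, B)` with `y ∈ B`. -/
def minT {Y : Type*} [Fintype Y] [DecidableEq Y] [Nonempty Y] (t : Y → Finset Y → ℕ) : ℕ :=
  (allPairs Y).inf' allPairs_nonempty fun p => t p.1 p.2

/-- A stochastic choice function on a finite set `Y`. -/
def IsSCF {Y : Type*} [Fintype Y] [DecidableEq Y] (P₀ : Y → Finset Y → ℝ) : Prop :=
  ∀ B : Finset Y, B.Nonempty → (∀ y ∈ B, 0 ≤ P₀ y B) ∧ (∑ y ∈ B, P₀ y B) = 1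


theorem sum_allPairs {Y : Type*} [Fintype Y] [DecidableEq Y] (f : Y → Finset Y → ℝ) :
    ∑ p ∈ allPairs Y, f p.1 p.2 = ∑ B : Finset Y, ∑ y ∈ B, f y B := by
  rw [allPairs, Finset.sum_filter, Fintype.sum_prod_type_right]
  refine Finset.sum_congr rfl fun B _ => ?_
  simp

/-- Weights summing to one on every nonempty set have total mass `2 ^ |Y| - 1`. -/
theorem sum_allPairs_eq_two_pow_sub_one {Y : Type*} [Fintype Y] [DecidableEq Y]
    (f : Y → Finset Y → ℝ) (hf : ∀ B : Finset Y, B.Nonempty → ∑ y ∈ B, f y B = 1) :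
    ∑ p ∈ allPairs Y, f p.1 p.2 = 2 ^ Fintype.card Y - 1 := by
  rw [sum_allPairs, ← Finset.sum_erase_add _ _ (Finset.mem_univ (∅ : Finset Y)),
    Finset.sum_congr rfl fun B hB =>
      hf B (Finset.nonempty_iff_ne_empty.2 (Finset.ne_of_mem_erase hB))]
  simp [Finset.card_erase_of_mem, Fintype.card_finset]

theorem sum_aFn {Y : Type*} (r : Y → Y → Prop) (hr : IsStrictTotalOrder Y r)
    (B : Finset Y) (hB : B.Nonempty) : ∑ y ∈ B, aFn r y B = 1 := by
  obtain ⟨b, hb, hmin⟩ : ∃ b ∈ B, ∀ y ∈ B, ¬ r y b := by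
    obtain ⟨⟨b, hb⟩, -, hmin⟩ := (B.finite_toSet.wellFoundedOn (r := r)).has_min Set.univ
      ⟨⟨_, hB.choose_spec⟩, trivial⟩
    exact ⟨b, hb, fun y hy => hmin ⟨y, hy⟩ trivial⟩
  rw [Finset.sum_eq_single_of_mem b hb]
  · exact if_pos hmin
  · intro y hy hyb
    refine if_neg fun h => hyb ?_
    exact Std.Trichotomous.trichotomous (r := r) y b (hmin y hy) (h b hb)

theorem aFn_nonneg {Y : Type*} (r : Y → Y → Prop) (y : Y) (B : Finset Y) : 0 ≤ aFn r y B := by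
  unfold aFn
  split_ifs <;> norm_num

/-- The effect of subtracting the minimum of `t` on a weighted sum. -/
theorem sum_mul_sub_minT {Y : Type*} [Fintype Y] [DecidableEq Y] [Nonempty Y]
    (f : Y → Finset Y → ℝ) (hf : ∀ B : Finset Y, B.Nonempty → ∑ y ∈ B, f y B = 1)
    (t : Y → Finset Y → ℕ) :
    ∑ p ∈ allPairs Y, f p.1 p.2 * ((t p.1 p.2 - minT t : ℕ) : ℝ) =
      ∑ p ∈ allPairs Y, f p.1 p.2 * t p.1 p.2 - (2 ^ Fintype.card Y - 1) * minT t := by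
  rw [← sum_allPairs_eq_two_pow_sub_one f hf, Finset.sum_mul, ← Finset.sum_sub_distrib]
  refine Finset.sum_congr rfl fun p hp => ?_
  have h : minT t ≤ t p.1 p.2 := Finset.inf'_le (fun p : Y × Finset Y => t p.1 p.2) hp
  rw [Nat.cast_sub h, mul_sub]

theorem maxT_sub_le {Y : Type*} [Fintype Y] [DecidableEq Y] [Nonempty Y]
    (t : Y → Finset Y → ℕ) (m : ℕ) : maxT (fun y B => t y B - m) ≤ maxT t - m :=
  Finset.sup'_le _ _ fun _ hp =>
    Nat.sub_le_sub_right (Finset.le_sup' (fun p : Y × Finset Y => t p.1 p.2) hp) m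

theorem minT_le_maxT {Y : Type*} [Fintype Y] [DecidableEq Y] [Nonempty Y]
    (t : Y → Finset Y → ℕ) : minT t ≤ maxT t := by
  obtain ⟨p, hp⟩ := allPairs_nonempty (Y := Y)
  exact (Finset.inf'_le (fun p : Y × Finset Y => t p.1 p.2) hp).trans
    (Finset.le_sup' (fun p : Y × Finset Y => t p.1 p.2) hp)

theorem stmt14 {Y : Type*} [Fintype Y] [DecidableEq Y] [Nonempty Y]
    (P₀ : Y → Finset Y → ℝ) (hSCF : IsSCF P₀) (ε : ℝ) (hε0 : 0 ≤ ε) (hε1 : ε ≤ 1)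
    (hARSPstar : ∀ t : Y → Finset Y → ℕ,
      (∑ p ∈ allPairs Y, P₀ p.1 p.2 * t p.1 p.2) ≤
        (1 - ε) * (⨆ r : SLO Y, ∑ p ∈ allPairs Y, aFn r.1 p.1 p.2 * t p.1 p.2)
          + (2 ^ Fintype.card Y - 1) * ε * (maxT t : ℝ)) :
    ∀ t : Y → Finset Y → ℕ,
      (∑ p ∈ allPairs Y, P₀ p.1 p.2 * t p.1 p.2) ≤
        (⨆ r : SLO Y, ∑ p ∈ allPairs Y, aFn r.1 p.1 p.2 * t p.1 p.2)
          + ((maxT t : ℝ) - (minT t : ℝ)) * ((2 ^ (Fintype.card Y + 1) - 2) * ε) / 2 := by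
  intro t
  have h := hARSPstar fun y B => t y B - minT t
  rw [sum_mul_sub_minT P₀ (fun B hB => (hSCF B hB).2) t] at h
  set S := ⨆ r : SLO Y, ∑ p ∈ allPairs Y, aFn r.1 p.1 p.2 * ((t p.1 p.2 - minT t : ℕ) : ℝ)
    with hS
  have hS0 : 0 ≤ S := Real.iSup_nonneg fun r => Finset.sum_nonneg fun p _ =>
    mul_nonneg (aFn_nonneg _ _ _) (Nat.cast_nonneg _)
  have hSle : S ≤ (⨆ r : SLO Y, ∑ p ∈ allPairs Y, aFn r.1 p.1 p.2 * t p.1 p.2)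
      - (2 ^ Fintype.card Y - 1) * minT t := by
    refine ciSup_le fun r => ?_
    rw [sum_mul_sub_minT (aFn r.1) (sum_aFn r.1 r.2) t]
    gcongr
    exact le_ciSup (f := fun r : SLO Y => ∑ p ∈ allPairs Y, aFn r.1 p.1 p.2 * (t p.1 p.2 : ℝ))
      (Set.finite_range _).bddAbove r
  have hM : (maxT (fun y B => t y B - minT t) : ℝ) ≤ maxT t - minT t := by
    rw [← Nat.cast_sub (minT_le_maxT t)]
    exact_mod_cast maxT_sub_le t (minT t)
  have hN : (0 : ℝ) ≤ 2 ^ Fintype.card Y - 1 :=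
    sub_nonneg.2 (one_le_pow₀ one_le_two)
  have hmul := mul_le_mul_of_nonneg_left hM (mul_nonneg hN hε0)
  have hεS := mul_nonneg hε0 hS0
  rw [pow_succ]
  linarith

end
end
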